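/- Let λ_1 ≥ λ_2 ≥ … ≥ λ_N ≥ 0 be integers. The number of semi-standard Young tableaux of shape λ = (λ_1,…,λ_N) with entries in {1,…,N} equals ∏_{1≤i<j≤N} (λ_i − λ_j + j − i)/(j − i). -/

import Mathlib

section BinomialDeterminant

open Matrix

/-- The matrix of binomial coefficients `(v i choose j)`. -/
def chooseMatrix {n : ℕ} (v : Fin n → ℤ) : Matrix (Fin n) (Fin n) ℤ :=
  of fun i j => Ring.choose (v i) (j : ℕ)

lemma sum_Ico_choose {a b : ℤ} (h : a ≤ b) (k : ℕ) :
    ∑ x ∈ Finset.Ico a b, Ring.choose x k =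
      Ring.choose b (k + 1) - Ring.choose a (k + 1) := by
  induction b, h using Int.leInduction with
  | base => simp
  | succ b hb ih =>
    rw [← Finset.insert_Ico_right_eq_Ico_add_one hb, Finset.sum_insert (by simp), ih,
      Ring.choose_succ_succ]
    ring

/-- Subtracting consecutive rows removes the column of ones of a binomial matrix. -/
lemma det_chooseMatrix_succ {n : ℕ} (v : Fin (n + 1) → ℤ) :
    (chooseMatrix v).det =
      (of fun i j : Fin n => Ring.choose (v i.succ) ((j : ℕ) + 1) -
        Ring.choose (v i.castSucc) ((j : ℕ) + 1)).det := by
  let B : Matrix (Fin (n + 1)) (Fin (n + 1)) ℤ :=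
    of (Fin.cons (chooseMatrix v 0)
      (fun i j => chooseMatrix v i.succ j - chooseMatrix v i.castSucc j))
  have hB : (chooseMatrix v).det = B.det :=
    det_eq_of_forall_row_eq_smul_add_pred (fun _ => 1) (by simp [B]) (by simp [B])
  rw [hB, det_succ_column_zero, Fin.sum_univ_succ]
  have h0 : ∀ i : Fin n, B i.succ 0 = 0 := by simp [B, chooseMatrix]
  have h1 : B 0 0 = 1 := by simp [B, chooseMatrix]
  simp only [h0, h1, mul_zero, zero_mul, Finset.sum_const_zero, add_zero, Fin.val_zero, pow_zero,
    one_mul]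
  congr 1

lemma det_chooseMatrix_eq_sum {n : ℕ} (v : Fin (n + 1) → ℤ) (hv : Monotone v) :
    (chooseMatrix v).det =
      ∑ w ∈ Fintype.piFinset fun i : Fin n => Finset.Ico (v i.castSucc) (v i.succ),
        (chooseMatrix w).det := by
  have h := (detRowAlternating (n := Fin n) (R := ℤ)).toMultilinearMap.map_sum_finset
    (fun _ (x : ℤ) (j : Fin n) => Ring.choose x (j : ℕ))
    (fun i : Fin n => Finset.Ico (v i.castSucc) (v i.succ))
  rw [det_chooseMatrix_succ]
  refine Eq.trans ?_ h
  change det _ = det _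
  congr 1
  ext i j
  rw [of_apply, Finset.sum_apply, sum_Ico_choose (hv (Fin.castSucc_lt_succ).le)]

lemma prod_factorial_mul_det_chooseMatrix {n : ℕ} (v : Fin n → ℤ) :
    (∏ i : Fin n, ((i : ℕ).factorial : ℤ)) * (chooseMatrix v).det =
      ∏ i : Fin n, ∏ j ∈ Finset.Ioi i, (v j - v i) := by
  rw [← det_vandermonde, det_eval_matrixOfPolynomials_eq_det_vandermonde v
    (fun j => descPochhammer ℤ j) (fun j => descPochhammer_natDegree ℤ j)
    (fun j => monic_descPochhammer ℤ j), ← det_mul_row]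
  congr 1
  ext i j
  rw [of_apply, of_apply, chooseMatrix, of_apply, ← nsmul_eq_mul,
    ← Ring.descPochhammer_eq_factorial_smul_choose, Polynomial.eval_eq_smeval]

lemma det_chooseMatrix_id (n : ℕ) : (chooseMatrix fun i : Fin n => (i : ℤ)).det = 1 := by
  rw [det_of_isLowerTriangular]
  · simp [chooseMatrix, Ring.choose_natCast]
  · intro i j hij
    simp only [chooseMatrix, of_apply, Ring.choose_natCast]
    exact_mod_cast Nat.choose_eq_zero_of_lt (by simpa using hij)

lemma det_chooseMatrix_eq_prod {n : ℕ} (v : Fin n → ℤ) :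
    ((chooseMatrix v).det : ℝ) =
      ∏ i : Fin n, ∏ j ∈ Finset.Ioi i, ((v j : ℝ) - v i) / ((j : ℕ) - (i : ℕ)) := by
  have hv := prod_factorial_mul_det_chooseMatrix v
  have hid := prod_factorial_mul_det_chooseMatrix fun i : Fin n => (i : ℤ)
  rw [det_chooseMatrix_id, mul_one] at hid
  have hpos : (∏ i : Fin n, ((i : ℕ).factorial : ℝ)) ≠ 0 :=
    Finset.prod_ne_zero_iff.2 fun i _ => Nat.cast_ne_zero.2 (Nat.factorial_ne_zero _)
  simp only [Finset.prod_div_distrib]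
  generalize (chooseMatrix v).det = D at hv ⊢
  have hv' := congrArg (Int.cast : ℤ → ℝ) hv
  have hid' := congrArg (Int.cast : ℤ → ℝ) hid
  push_cast at hv' hid'
  rw [← hv', ← hid', mul_div_cancel_left₀ _ hpos]

end BinomialDeterminant

section Branching

/-- The semistandard tableaux of shape `μ` with entries smaller than `N`. -/
abbrev BoundedTableau (N : ℕ) (μ : YoungDiagram) :=
  {T : SemistandardYoungTableau μ // ∀ i j, (i, j) ∈ μ → T i j < N}

instance BoundedTableau.finite (N : ℕ) (μ : YoungDiagram) : Finite (BoundedTableau N μ) := by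
  refine Finite.of_injective
    (fun (T : BoundedTableau N μ) (c : μ.cells) => (⟨T.1 c.1.1 c.1.2, T.2 _ _ c.2⟩ : Fin N)) ?_
  intro S T h
  ext i j
  by_cases hc : (i, j) ∈ μ
  · simpa using congrFun h ⟨(i, j), hc⟩
  · rw [S.1.zeros hc, T.1.zeros hc]

lemma SemistandardYoungTableau.le_apply {μ : YoungDiagram} (T : SemistandardYoungTableau μ)
    {i j : ℕ} (h : (i, j) ∈ μ) : i ≤ T i j := by
  induction i with
  | zero => simp
  | succ i ih =>
    exact (ih (μ.up_left_mem i.le_succ le_rfl h)).trans_lt (T.col_strict i.lt_succ_self h)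

/-- `ν` has at most `N` rows and `μ / ν` is a horizontal strip. -/
structure Interlaces (N : ℕ) (μ ν : YoungDiagram) : Prop where
  mem_of_mem : ∀ i j, (i, j) ∈ ν → (i, j) ∈ μ
  mem_of_succ_mem : ∀ i j, (i + 1, j) ∈ μ → (i, j) ∈ ν
  row_lt : ∀ i j, (i, j) ∈ ν → i < N

/-- Extend a tableau of shape `ν` to one of shape `μ` by filling the new cells with `N`. -/
def extendTableau {N : ℕ} {μ ν : YoungDiagram} (h : Interlaces N μ ν) (S : BoundedTableau N ν) :
    BoundedTableau (N + 1) μ where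
  val :=
    { entry := fun i j => if (i, j) ∈ ν then S.1 i j else if (i, j) ∈ μ then N else 0
      row_weak' := by
        intro i j₁ j₂ hj hμ
        have hμ' := μ.up_left_mem le_rfl hj.le hμ
        by_cases h₂ : (i, j₂) ∈ ν
        · simpa [h₂, ν.up_left_mem le_rfl hj.le h₂] using S.1.row_weak hj h₂
        · by_cases h₁ : (i, j₁) ∈ ν
          · simpa [h₁, h₂, hμ] using (S.2 _ _ h₁).le
          · simp [h₁, h₂, hμ, hμ']
      col_strict' := by
        intro i₁ i₂ j hi hμ
        have h₁ : (i₁, j) ∈ ν := h.mem_of_succ_mem _ _ (μ.up_left_mem hi le_rfl hμ)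
        by_cases h₂ : (i₂, j) ∈ ν
        · simpa [h₁, h₂] using S.1.col_strict hi h₂
        · simpa [h₁, h₂, hμ] using S.2 _ _ h₁
      zeros' := by
        intro i j hμ
        simp [hμ, mt (h.mem_of_mem i j) hμ] }
  property := by
    intro i j hμ
    change (if (i, j) ∈ ν then S.1 i j else if (i, j) ∈ μ then N else 0) < N + 1
    split_ifs with hν
    · exact (S.2 _ _ hν).trans N.lt_succ_self
    · exact N.lt_succ_self

lemma extendTableau_apply {N : ℕ} {μ ν : YoungDiagram} (h : Interlaces N μ ν)
    (S : BoundedTableau N ν) (i j : ℕ) :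
    (extendTableau h S).1 i j = if (i, j) ∈ ν then S.1 i j else if (i, j) ∈ μ then N else 0 :=
  rfl

lemma mem_iff_extendTableau_lt {N : ℕ} {μ ν : YoungDiagram} (h : Interlaces N μ ν)
    (S : BoundedTableau N ν) (i j : ℕ) :
    (i, j) ∈ ν ↔ (i, j) ∈ μ ∧ (extendTableau h S).1 i j < N := by
  rw [extendTableau_apply]
  constructor
  · intro hν
    simpa [hν, h.mem_of_mem _ _ hν] using S.2 _ _ hν
  · rintro ⟨hμ, hlt⟩
    by_contra hν
    simp [hμ, hν] at hlt

/-- The cells of a tableau with entries smaller than `N`. -/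
def restrictShape (N : ℕ) {μ : YoungDiagram} (T : SemistandardYoungTableau μ) : YoungDiagram where
  cells := μ.cells.filter fun c => T c.1 c.2 < N
  isLowerSet := by
    rintro ⟨i₂, j₂⟩ ⟨i₁, j₁⟩ ⟨hi : i₁ ≤ i₂, hj : j₁ ≤ j₂⟩ hc
    simp only [Finset.coe_filter, YoungDiagram.mem_cells, Set.mem_ofPred_eq] at hc ⊢
    refine ⟨μ.up_left_mem hi hj hc.1, lt_of_le_of_lt ?_ hc.2⟩
    exact (T.row_weak_of_le hj (μ.up_left_mem hi le_rfl hc.1)).trans (T.col_weak hi hc.1)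

lemma mem_restrictShape {N : ℕ} {μ : YoungDiagram} {T : SemistandardYoungTableau μ} {i j : ℕ} :
    (i, j) ∈ restrictShape N T ↔ (i, j) ∈ μ ∧ T i j < N := by
  simp [← YoungDiagram.mem_cells, restrictShape]

lemma interlaces_restrictShape {N : ℕ} {μ : YoungDiagram} (T : BoundedTableau (N + 1) μ) :
    Interlaces N μ (restrictShape N T.1) where
  mem_of_mem _ _ h := (mem_restrictShape.1 h).1
  mem_of_succ_mem i j h := mem_restrictShape.2 ⟨μ.up_left_mem i.le_succ le_rfl h,
    (T.1.col_strict i.lt_succ_self h).trans_le (Nat.lt_succ_iff.1 (T.2 _ _ h))⟩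
  row_lt _ _ h := by
    rw [mem_restrictShape] at h
    exact (T.1.le_apply h.1).trans_lt h.2

/-- Forget the entries of a tableau that are at least `N`. -/
def restrictTableau {N : ℕ} {μ : YoungDiagram} (T : SemistandardYoungTableau μ) :
    BoundedTableau N (restrictShape N T) where
  val :=
    { entry := fun i j => if (i, j) ∈ restrictShape N T then T i j else 0
      row_weak' := by
        intro i j₁ j₂ hj h
        rw [if_pos h, if_pos (YoungDiagram.up_left_mem _ le_rfl hj.le h)]
        exact T.row_weak hj (mem_restrictShape.1 h).1
      col_strict' := by
        intro i₁ i₂ j hi h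
        rw [if_pos h, if_pos (YoungDiagram.up_left_mem _ hi.le le_rfl h)]
        exact T.col_strict hi (mem_restrictShape.1 h).1
      zeros' := fun h => if_neg h }
  property := by
    intro i j h
    change (if (i, j) ∈ restrictShape N T then T i j else 0) < N
    rw [if_pos h]
    exact (mem_restrictShape.1 h).2

lemma restrictTableau_apply {N : ℕ} {μ : YoungDiagram} (T : SemistandardYoungTableau μ)
    (i j : ℕ) :
    (restrictTableau (N := N) T).1 i j = if (i, j) ∈ restrictShape N T then T i j else 0 :=
  rfl

lemma extendTableau_bijective (N : ℕ) (μ : YoungDiagram) :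
    Function.Bijective fun p : Σ ν : {ν // Interlaces N μ ν}, BoundedTableau N ν.1 =>
      extendTableau p.1.2 p.2 := by
  constructor
  · rintro ⟨⟨ν₁, h₁⟩, S₁⟩ ⟨⟨ν₂, h₂⟩, S₂⟩ h
    dsimp only at h S₁ S₂
    obtain rfl : ν₁ = ν₂ := by
      refine SetLike.ext ?_
      rintro ⟨i, j⟩
      rw [mem_iff_extendTableau_lt h₁ S₁, mem_iff_extendTableau_lt h₂ S₂, h]
    congr 1
    ext i j
    by_cases hν : (i, j) ∈ ν₁
    · have := congrArg (fun T : BoundedTableau (N + 1) μ => T.1 i j) h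
      simpa [extendTableau_apply, hν] using this
    · rw [S₁.1.zeros hν, S₂.1.zeros hν]
  · intro T
    refine ⟨⟨⟨_, interlaces_restrictShape T⟩, restrictTableau T.1⟩, ?_⟩
    ext i j
    rw [extendTableau_apply, restrictTableau_apply]
    split_ifs with hν hμ
    · rfl
    · rw [mem_restrictShape] at hν
      have := T.2 _ _ hμ
      have := not_and.1 hν hμ
      lia
    · exact (T.1.zeros hμ).symm

/-- The strictly increasing sequence `i - μ_i`. -/
def shiftedRows (N : ℕ) (μ : YoungDiagram) (i : Fin N) : ℤ := (i : ℕ) - (μ.rowLen i : ℤ)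

lemma shiftedRows_monotone (N : ℕ) (μ : YoungDiagram) : Monotone (shiftedRows N μ) := by
  intro i j hij
  have := μ.rowLen_anti i j hij
  have : (i : ℕ) ≤ j := hij
  unfold shiftedRows
  lia

/-- The interval in which the shifted rows of a diagram interlacing `μ` lie. -/
noncomputable abbrev interlacingBox (N : ℕ) (μ : YoungDiagram) : Finset (Fin N → ℤ) :=
  Fintype.piFinset fun i : Fin N =>
    Finset.Ico (shiftedRows (N + 1) μ i.castSucc) (shiftedRows (N + 1) μ i.succ)

lemma mem_interlacingBox {N : ℕ} {μ : YoungDiagram} {w : Fin N → ℤ} :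
    w ∈ interlacingBox N μ ↔ ∀ i : Fin N,
      (i : ℕ) - (μ.rowLen i : ℤ) ≤ w i ∧ w i ≤ (i : ℕ) - (μ.rowLen (i + 1) : ℤ) := by
  simp only [Fintype.mem_piFinset, Finset.mem_Ico, shiftedRows, Fin.val_castSucc, Fin.val_succ]
  refine forall_congr' fun i => and_congr_right fun _ => ?_
  push_cast
  lia

lemma YoungDiagram.rowLen_le_of_forall_mem {μ ν : YoungDiagram} {i k : ℕ}
    (h : ∀ j, (i, j) ∈ μ → (k, j) ∈ ν) : μ.rowLen i ≤ ν.rowLen k := by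
  simp only [YoungDiagram.mem_iff_lt_rowLen] at h
  by_contra! hlt
  exact lt_irrefl _ (h _ hlt)

lemma shiftedRows_mem_interlacingBox {N : ℕ} {μ ν : YoungDiagram} (h : Interlaces N μ ν) :
    shiftedRows N ν ∈ interlacingBox N μ := by
  rw [mem_interlacingBox]
  intro i
  have h₁ := YoungDiagram.rowLen_le_of_forall_mem (h.mem_of_mem i)
  have h₂ := YoungDiagram.rowLen_le_of_forall_mem (h.mem_of_succ_mem i)
  unfold shiftedRows
  lia

/-- The diagram interlacing `μ` whose shifted rows are `w`. -/
noncomputable def diagramOfBox {N : ℕ} {μ : YoungDiagram} {w : Fin N → ℤ} (hw : w ∈ interlacingBox N μ) :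
    YoungDiagram where
  cells := μ.cells.filter fun c => ∃ h : c.1 < N, (c.2 : ℤ) < c.1 - w ⟨c.1, h⟩
  isLowerSet := by
    rintro ⟨i₂, j₂⟩ ⟨i₁, j₁⟩ ⟨hi : i₁ ≤ i₂, hj : j₁ ≤ j₂⟩ hc
    simp only [Finset.coe_filter, YoungDiagram.mem_cells, Set.mem_ofPred_eq] at hc ⊢
    obtain ⟨hμ, hN, hlt⟩ := hc
    refine ⟨μ.up_left_mem hi hj hμ, hi.trans_lt hN, ?_⟩
    rcases hi.eq_or_lt with rfl | hi
    · lia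
    · have h₁ := (mem_interlacingBox.1 hw ⟨i₁, hi.trans hN⟩).2
      have h₂ := μ.rowLen_anti (i₁ + 1) i₂ hi
      rw [YoungDiagram.mem_iff_lt_rowLen] at hμ
      dsimp only at h₁
      lia

lemma mem_diagramOfBox {N : ℕ} {μ : YoungDiagram} {w : Fin N → ℤ} (hw : w ∈ interlacingBox N μ)
    {i j : ℕ} :
    (i, j) ∈ diagramOfBox hw ↔ (i, j) ∈ μ ∧ ∃ h : i < N, (j : ℤ) < i - w ⟨i, h⟩ := by
  simp [← YoungDiagram.mem_cells, diagramOfBox]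

lemma interlaces_diagramOfBox {N : ℕ} {μ : YoungDiagram} {w : Fin N → ℤ}
    (hw : w ∈ interlacingBox N μ) (hμ : ∀ i, N + 1 ≤ i → μ.rowLen i = 0) :
    Interlaces N μ (diagramOfBox hw) where
  mem_of_mem _ _ h := ((mem_diagramOfBox hw).1 h).1
  mem_of_succ_mem i j h := by
    refine (mem_diagramOfBox hw).2 ⟨μ.up_left_mem i.le_succ le_rfl h, ?_⟩
    rw [YoungDiagram.mem_iff_lt_rowLen] at h
    have hi : i < N := by
      by_contra! hi
      have := hμ (i + 1) (by lia)
      lia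
    have := (mem_interlacingBox.1 hw ⟨i, hi⟩).2
    dsimp only at this
    exact ⟨hi, by lia⟩
  row_lt _ _ h := ((mem_diagramOfBox hw).1 h).2.1

lemma shiftedRows_diagramOfBox {N : ℕ} {μ : YoungDiagram} {w : Fin N → ℤ}
    (hw : w ∈ interlacingBox N μ) : shiftedRows N (diagramOfBox hw) = w := by
  funext i
  have h₁ := mem_interlacingBox.1 hw i
  have h₂ : ∀ j : ℕ, j < (diagramOfBox hw).rowLen i ↔ j < μ.rowLen i ∧ (j : ℤ) < i - w i := by
    intro j
    rw [← YoungDiagram.mem_iff_lt_rowLen, mem_diagramOfBox, YoungDiagram.mem_iff_lt_rowLen]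
    simp
  have h₃ : (diagramOfBox hw).rowLen i = ((i : ℤ) - w i).toNat := by
    refine eq_of_forall_lt_iff fun j => ?_
    rw [h₂]
    lia
  unfold shiftedRows
  lia

lemma shiftedRows_bijective {N : ℕ} {μ : YoungDiagram} (hμ : ∀ i, N + 1 ≤ i → μ.rowLen i = 0) :
    Function.Bijective fun ν : {ν // Interlaces N μ ν} =>
      (⟨shiftedRows N ν.1, shiftedRows_mem_interlacingBox ν.2⟩ : interlacingBox N μ) := by
  constructor
  · rintro ⟨ν₁, h₁⟩ ⟨ν₂, h₂⟩ h
    simp only [Subtype.mk.injEq] at h ⊢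
    refine SetLike.ext ?_
    rintro ⟨i, j⟩
    by_cases hi : i < N
    · have := congrFun h ⟨i, hi⟩
      simp only [shiftedRows] at this
      simp only [YoungDiagram.mem_iff_lt_rowLen]
      lia
    · exact iff_of_false (mt (h₁.row_lt i j) hi) (mt (h₂.row_lt i j) hi)
  · rintro ⟨w, hw⟩
    exact ⟨⟨_, interlaces_diagramOfBox hw hμ⟩, Subtype.ext (shiftedRows_diagramOfBox hw)⟩

lemma card_boundedTableau_zero {μ : YoungDiagram} (hμ : ∀ i, μ.rowLen i = 0) :
    Nat.card (BoundedTableau 0 μ) = 1 := by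
  have hmem : ∀ i j, (i, j) ∉ μ := by simp [YoungDiagram.mem_iff_lt_rowLen, hμ]
  rw [Nat.card_eq_one_iff_unique]
  refine ⟨⟨fun S T => ?_⟩, ⟨⟨default, fun i j h => absurd h (hmem i j)⟩⟩⟩
  ext i j
  rw [S.1.zeros (hmem i j), T.1.zeros (hmem i j)]

theorem card_boundedTableau_eq_det (N : ℕ) (μ : YoungDiagram)
    (hμ : ∀ i, N ≤ i → μ.rowLen i = 0) :
    (Nat.card (BoundedTableau N μ) : ℤ) = (chooseMatrix (shiftedRows N μ)).det := by
  induction N generalizing μ with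
  | zero =>
    rw [card_boundedTableau_zero fun i => hμ i i.zero_le, Matrix.det_isEmpty, Nat.cast_one]
  | succ N ih =>
    let e := Equiv.ofBijective _ (shiftedRows_bijective hμ)
    have : Fintype {ν // Interlaces N μ ν} := Fintype.ofEquiv _ e.symm
    rw [← Nat.card_eq_of_bijective _ (extendTableau_bijective N μ), Nat.card_sigma,
      det_chooseMatrix_eq_sum _ (shiftedRows_monotone _ μ),
      ← Finset.sum_coe_sort (interlacingBox N μ) fun w => (chooseMatrix w).det, Nat.cast_sum]
    refine Fintype.sum_equiv e _ (fun w => (chooseMatrix w.1).det) fun ν => ih ν.1 fun i hi => ?_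
    by_contra hne
    have h := ν.2.row_lt i 0 (YoungDiagram.mem_iff_lt_rowLen.2 (Nat.pos_of_ne_zero hne))
    lia

end Branching

/-- Lemma 2.3: the number of semi-standard Young tableaux of shape `λ = (λ_1 ≥ … ≥ λ_N)`
with entries in `{1,…,N}` (formalized with 0-indexed entries in `{0,…,N−1}`) equals
`∏_{1≤i<j≤N} (λ_i − λ_j + j − i)/(j − i)`, where `λ_i = μ.rowLen (i-1)`. -/
theorem stmt12 (N : ℕ) (μ : YoungDiagram) (hrows : ∀ i, N ≤ i → μ.rowLen i = 0) :
    (Nat.card {T : SemistandardYoungTableau μ // ∀ i j, (i, j) ∈ μ → T i j < N} : ℝ) =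
      ∏ i : Fin N, ∏ j ∈ Finset.Ioi i,
        ((μ.rowLen i : ℝ) - (μ.rowLen j : ℝ) + (j : ℕ) - (i : ℕ)) / ((j : ℕ) - (i : ℕ)) := by
  rw [← Int.cast_natCast (R := ℝ), card_boundedTableau_eq_det N μ hrows, det_chooseMatrix_eq_prod]
  refine Finset.prod_congr rfl fun i _ => Finset.prod_congr rfl fun j _ => ?_
  simp only [shiftedRows]
  push_cast
  ring
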